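/- Let M be a submonoid of the monoid H(τ) of hypersubstitutions of type τ. A set Σ of quasi-identities of type τ is the set of all quasi-identities M-hypersatisfied in some class K of algebras of type τ if and only if Σ is M-hyperclosed, i.e., Σ contains all axioms of the calculus Q and is closed under the substitution rule, the M-hypersubstitution rule, the cut rule, and the extension rule. -/

import Mathlib

open scoped Classical

/-- Terms of a type `τ = (I, ar)`: an indexed family of operation symbols `I`
with arities `ar`, over countably many variables. -/
inductive Trm (I : Type) (ar : I → ℕ) : Type
  | var : ℕ → Trm I ar
  | app (f : I) : (Fin (ar f) → Trm I ar) → Trm I ar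

variable {I : Type} {ar : I → ℕ}

/-- Simultaneous substitution of terms for variables. -/
def Trm.subst (δ : ℕ → Trm I ar) : Trm I ar → Trm I ar
  | .var n => δ n
  | .app f ts => .app f fun i => (ts i).subst δ

/-- A hypersubstitution assigns to each operation symbol `f` a term `σ(f)`. -/
def Hyp (I : Type) (ar : I → ℕ) := (f : I) → Trm I ar

/-- The extension of a hypersubstitution to all terms. -/
def Hyp.apply (σ : Hyp I ar) : Trm I ar → Trm I ar
  | .var n => .var n
  | .app f ts => (σ f).subst fun n => if h : n < ar f then σ.apply (ts ⟨n, h⟩) else .var n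

/-- The identity hypersubstitution `σ_id`. -/
def Hyp.id (I : Type) (ar : I → ℕ) : Hyp I ar := fun f => .app f fun i => .var i

/-- Composition of hypersubstitutions: `(σ₁ ∘ σ₂)(f) = σ₁(σ₂(f))`. -/
def Hyp.comp (σ₁ σ₂ : Hyp I ar) : Hyp I ar := fun f => σ₁.apply (σ₂ f)

/-- Occurrence of the variable `m` in a term. -/
inductive Occurs (m : ℕ) : Trm I ar → Prop
  | var : Occurs m (.var m)
  | app {f ts} (i : Fin (ar f)) : Occurs m (ts i) → Occurs m (.app f ts)

/-- `σ` is a genuine hypersubstitution: `σ(f)` is an `(ar f)`-ary term,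
i.e. its variables are among `x₀, …, x_{ar f - 1}`.  The set `{σ | IsHyp σ}`
plays the role of the monoid `H(τ)` of all hypersubstitutions of type `τ`. -/
def IsHyp (σ : Hyp I ar) : Prop := ∀ f m, Occurs m (σ f) → m < ar f

/-- An identity `t ≈ s` of type `τ`. -/
abbrev Eqn (I : Type) (ar : I → ℕ) := Trm I ar × Trm I ar

/-- A quasi-identity `Δ → α` of type `τ`: a finite set `Δ` of identities
(the premises) together with an identity `α` (the conclusion). -/
abbrev Quasi (I : Type) (ar : I → ℕ) := Finset (Eqn I ar) × Eqn I ar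

/-- Applying a map on terms to every term occurring in a quasi-identity. -/
noncomputable def mapQ (g : Trm I ar → Trm I ar) (q : Quasi I ar) : Quasi I ar :=
  (q.1.image fun p => (g p.1, g p.2), (g q.2.1, g q.2.2))

/-- An algebra of type `τ`. -/
structure Alg (I : Type) (ar : I → ℕ) where
  carrier : Type
  ops : (f : I) → (Fin (ar f) → carrier) → carrier

/-- Evaluation of a term in an algebra under an assignment `v`. -/
def Alg.eval (A : Alg I ar) (v : ℕ → A.carrier) : Trm I ar → A.carrier
  | .var n => v n
  | .app f ts => A.ops f fun i => A.eval v (ts i)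

/-- Satisfaction of a quasi-identity in an algebra: every assignment making all
premises hold makes the conclusion hold. -/
def Alg.Sat (A : Alg I ar) (q : Quasi I ar) : Prop :=
  ∀ v : ℕ → A.carrier,
    (∀ p ∈ q.1, A.eval v p.1 = A.eval v p.2) → A.eval v q.2.1 = A.eval v q.2.2

/-- `M`-hypersatisfaction of a quasi-identity in an algebra: `A` satisfies
`σ(q)` for every hypersubstitution `σ ∈ M`. -/
def Alg.HypSatM (A : Alg I ar) (M : Set (Hyp I ar)) (q : Quasi I ar) : Prop :=
  ∀ σ ∈ M, A.Sat (mapQ (Hyp.apply σ) q)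

/-- The quasi-equational calculus `Q` (when `M = ∅`), resp. its extension by the
hypersubstitution rule for the hypersubstitutions of `M`: `MHQ` for a submonoid
`M ⊆ H(τ)`, and `HQ` when `M = {σ | IsHyp σ} = H(τ)`. -/
inductive Der (M : Set (Hyp I ar)) (S : Set (Quasi I ar)) : Quasi I ar → Prop
  | hyp {q} : q ∈ S → Der M S q
  | refl (p : Trm I ar) : Der M S (∅, (p, p))
  | assm (α : Eqn I ar) : Der M S ({α}, α)
  | symm (p q : Trm I ar) : Der M S ({(p, q)}, (q, p))
  | trans (p q r : Trm I ar) : Der M S ({(p, q), (q, r)}, (p, r))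
  | compat (f : I) (t s : Fin (ar f) → Trm I ar) :
      Der M S (Finset.univ.image fun i => (t i, s i), (.app f t, .app f s))
  | subst {q} (δ : ℕ → Trm I ar) : Der M S q → Der M S (mapQ (Trm.subst δ) q)
  | hypsub {q} {σ : Hyp I ar} : σ ∈ M → Der M S q → Der M S (mapQ (Hyp.apply σ) q)
  | cut {Δ Γ : Finset (Eqn I ar)} {α β : Eqn I ar} :
      Der M S (Δ, α) → Der M S (insert α Γ, β) → Der M S (Δ ∪ Γ, β)
  | ext {Δ : Finset (Eqn I ar)} {α : Eqn I ar} (β : Eqn I ar) :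
      Der M S (Δ, α) → Der M S (insert β Δ, α)

/-- `Σ` is `M`-hyperclosed: it contains all axioms of the calculus `Q` and is
closed under the substitution rule, the `M`-hypersubstitution rule, the cut rule
and the extension rule. -/
def MHyperclosed (M : Set (Hyp I ar)) (S : Set (Quasi I ar)) : Prop :=
  (∀ p : Trm I ar, (∅, (p, p)) ∈ S) ∧
  (∀ α : Eqn I ar, ({α}, α) ∈ S) ∧
  (∀ p q : Trm I ar, ({(p, q)}, (q, p)) ∈ S) ∧
  (∀ p q r : Trm I ar, ({(p, q), (q, r)}, (p, r)) ∈ S) ∧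
  (∀ (f : I) (t s : Fin (ar f) → Trm I ar),
    (Finset.univ.image fun i => (t i, s i), (Trm.app f t, Trm.app f s)) ∈ S) ∧
  (∀ q ∈ S, ∀ δ : ℕ → Trm I ar, mapQ (Trm.subst δ) q ∈ S) ∧
  (∀ q ∈ S, ∀ σ ∈ M, mapQ (Hyp.apply σ) q ∈ S) ∧
  (∀ (Δ Γ : Finset (Eqn I ar)) (α β : Eqn I ar),
    (Δ, α) ∈ S → (insert α Γ, β) ∈ S → (Δ ∪ Γ, β) ∈ S) ∧
  (∀ (Δ : Finset (Eqn I ar)) (α β : Eqn I ar), (Δ, α) ∈ S → (insert β Δ, α) ∈ S)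

theorem Trm.subst_congr {δ ε : ℕ → Trm I ar} (t : Trm I ar)
    (h : ∀ n, Occurs n t → δ n = ε n) : t.subst δ = t.subst ε := by
  induction t with
  | var n => exact h n .var
  | app f ts ih =>
    simp only [Trm.subst]
    congr 1
    funext i
    exact ih i fun n hn => h n (.app i hn)

theorem Trm.subst_subst (δ ε : ℕ → Trm I ar) (t : Trm I ar) :
    (t.subst δ).subst ε = t.subst fun n => (δ n).subst ε := by
  induction t with
  | var n => rfl
  | app f ts ih => simp only [Trm.subst, ih]

theorem Trm.subst_var (t : Trm I ar) : t.subst Trm.var = t := by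
  induction t with
  | var n => rfl
  | app f ts ih => simp only [Trm.subst, ih]

theorem Hyp.apply_id (t : Trm I ar) : (Hyp.id I ar).apply t = t := by
  induction t with
  | var n => rfl
  | app f ts ih =>
    have h : (Hyp.id I ar).apply (.app f ts) = .app f fun i => (Hyp.id I ar).apply (ts i) := by
      simp [Hyp.apply, Hyp.id, Trm.subst]
    simp only [h, ih]

/-- A hypersubstitution carries a substitution instance of `t` to a substitution
instance of the image of `t`. -/
theorem Hyp.apply_subst {σ : Hyp I ar} (hσ : IsHyp σ) (δ : ℕ → Trm I ar) (t : Trm I ar) :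
    σ.apply (t.subst δ) = (σ.apply t).subst fun n => σ.apply (δ n) := by
  induction t with
  | var n => rfl
  | app f ts ih =>
    simp only [Trm.subst, Hyp.apply, Trm.subst_subst]
    refine Trm.subst_congr _ fun n hn => ?_
    simp only [dif_pos (hσ f n hn), ih]

theorem Hyp.apply_comp {σ : Hyp I ar} (hσ : IsHyp σ) (ρ : Hyp I ar) (t : Trm I ar) :
    (σ.comp ρ).apply t = σ.apply (ρ.apply t) := by
  induction t with
  | var n => rfl
  | app f ts ih =>
    simp only [Hyp.apply, Hyp.apply_subst hσ, Hyp.comp]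
    refine Trm.subst_congr _ fun n _ => ?_
    split_ifs with h
    · exact ih ⟨n, h⟩
    · rfl

theorem Alg.eval_subst (A : Alg I ar) (v : ℕ → A.carrier) (δ : ℕ → Trm I ar) (t : Trm I ar) :
    A.eval v (t.subst δ) = A.eval (fun n => A.eval v (δ n)) t := by
  induction t with
  | var n => rfl
  | app f ts ih => simp only [Trm.subst, Alg.eval, ih]

theorem Alg.sat_mapQ (A : Alg I ar) (g : Trm I ar → Trm I ar) (q : Quasi I ar) :
    A.Sat (mapQ g q) ↔ ∀ v : ℕ → A.carrier,
      (∀ p ∈ q.1, A.eval v (g p.1) = A.eval v (g p.2)) →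
        A.eval v (g q.2.1) = A.eval v (g q.2.2) := by
  simp only [Alg.Sat, mapQ, Finset.forall_mem_image]

theorem Alg.eval_apply_congr (A : Alg I ar) (v : ℕ → A.carrier) (σ : Hyp I ar) (f : I)
    (t s : Fin (ar f) → Trm I ar)
    (h : ∀ i, A.eval v (σ.apply (t i)) = A.eval v (σ.apply (s i))) :
    A.eval v (σ.apply (.app f t)) = A.eval v (σ.apply (.app f s)) := by
  simp only [Hyp.apply, Alg.eval_subst]
  congr 1
  funext n
  split_ifs with hn
  · exact h ⟨n, hn⟩
  · rfl

theorem mHyperclosed_hypSatM {M : Set (Hyp I ar)} (hM : ∀ σ ∈ M, IsHyp σ)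
    (hcomp : ∀ σ₁ ∈ M, ∀ σ₂ ∈ M, Hyp.comp σ₁ σ₂ ∈ M) (K : Set (Alg I ar)) :
    MHyperclosed M {q : Quasi I ar | ∀ A ∈ K, A.HypSatM M q} := by
  simp only [MHyperclosed, Set.mem_ofPred_eq, Alg.HypSatM, Alg.sat_mapQ]
  refine ⟨?_, ?_, ?_, ?_, ?_, ?_, ?_, ?_, ?_⟩
  · intro p A _ σ _ v _
    trivial
  · intro α A _ σ _ v h
    exact h α (by simp)
  · intro p q A _ σ _ v h
    exact (h (p, q) (by simp)).symm
  · intro p q r A _ σ _ v h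
    exact (h (p, q) (by simp)).trans (h (q, r) (by simp))
  · intro f t s A _ σ _ v h
    exact A.eval_apply_congr v σ f t s fun i => h (t i, s i)
      (Finset.mem_image_of_mem _ (Finset.mem_univ i))
  · intro q hq δ A hA σ hσ v h
    simp only [mapQ, Finset.forall_mem_image, Hyp.apply_subst (hM σ hσ), Alg.eval_subst] at h ⊢
    exact hq A hA σ hσ _ h
  · intro q hq ρ hρ A hA σ hσ v h
    simp only [mapQ, Finset.forall_mem_image, ← Hyp.apply_comp (hM σ hσ)] at h ⊢
    exact hq A hA _ (hcomp σ hσ ρ hρ) v h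
  · intro Δ Γ α β h₁ h₂ A hA σ hσ v h
    refine h₂ A hA σ hσ v fun p hp => ?_
    rcases Finset.mem_insert.1 hp with rfl | hp
    · exact h₁ A hA σ hσ v fun p hp => h p (Finset.mem_union_left _ hp)
    · exact h p (Finset.mem_union_right _ hp)
  · intro Δ α β h₁ A hA σ hσ v h
    exact h₁ A hA σ hσ v fun p hp => h p (Finset.mem_insert_of_mem hp)

namespace MHyperclosed

variable {M : Set (Hyp I ar)} {S : Set (Quasi I ar)}

theorem weaken (h : MHyperclosed M S) {Γ : Finset (Eqn I ar)} {α : Eqn I ar}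
    (hα : (Γ, α) ∈ S) (Δ : Finset (Eqn I ar)) : (Δ ∪ Γ, α) ∈ S := by
  obtain ⟨-, -, -, -, -, -, -, -, hext⟩ := h
  induction Δ using Finset.induction_on with
  | empty => simpa using hα
  | insert β Δ _ ih => simpa [Finset.insert_union] using hext _ _ β ih

/-- A consequence of premises that are all derivable from `Δ` is derivable from `Δ`. -/
theorem cut_all (h : MHyperclosed M S) {Δ Γ : Finset (Eqn I ar)} {α : Eqn I ar}
    (hΓ : ∀ γ ∈ Γ, (Δ, γ) ∈ S) (hα : (Γ, α) ∈ S) : (Δ, α) ∈ S := by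
  have key : ∀ Γ : Finset (Eqn I ar), (∀ γ ∈ Γ, (Δ, γ) ∈ S) → (Γ ∪ Δ, α) ∈ S → (Δ, α) ∈ S := by
    intro Γ
    induction Γ using Finset.induction_on with
    | empty => simp
    | insert β Γ _ ih =>
      intro hΓ hα
      obtain ⟨-, -, -, -, -, -, -, hcut, -⟩ := h
      refine ih (fun γ hγ => hΓ γ (Finset.mem_insert_of_mem hγ)) ?_
      have := hcut Δ (Γ ∪ Δ) β α (hΓ β (Finset.mem_insert_self _ _))
        (by rwa [← Finset.insert_union])
      rwa [Finset.union_eq_right.2 Finset.subset_union_right] at this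
  refine key Γ hΓ ?_
  rw [Finset.union_comm]
  exact h.weaken hα Δ

theorem mem_of_mem (h : MHyperclosed M S) {Δ : Finset (Eqn I ar)} {α : Eqn I ar} (hα : α ∈ Δ) :
    (Δ, α) ∈ S := by
  have := h.weaken (h.2.1 α) Δ
  rwa [Finset.union_eq_left.2 (Finset.singleton_subset_iff.2 hα)] at this

/-- The equivalence of terms identified by the consequences of `Δ`. -/
def setoid (h : MHyperclosed M S) (Δ : Finset (Eqn I ar)) : Setoid (Trm I ar) where
  r t s := (Δ, (t, s)) ∈ S
  iseqv :=
    { refl := fun t => h.cut_all (by simp) (h.1 t)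
      symm := fun {t s} hts => h.cut_all (by simpa using hts) (h.2.2.1 t s)
      trans := fun {t s u} hts hsu =>
        h.cut_all (by simpa using ⟨hts, hsu⟩) (h.2.2.2.1 t s u) }

/-- The quotient of the term algebra by the consequences of `Δ`. -/
noncomputable def quotientAlg (h : MHyperclosed M S) (Δ : Finset (Eqn I ar)) : Alg I ar where
  carrier := Quotient (h.setoid Δ)
  ops f x := Quotient.mk (h.setoid Δ) (.app f fun i => (x i).out)

theorem quotientAlg_eval (h : MHyperclosed M S) (Δ : Finset (Eqn I ar)) (δ : ℕ → Trm I ar)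
    (t : Trm I ar) :
    (h.quotientAlg Δ).eval (fun n => Quotient.mk (h.setoid Δ) (δ n)) t =
      Quotient.mk (h.setoid Δ) (t.subst δ) := by
  induction t with
  | var n => rfl
  | app f ts ih =>
    simp only [Alg.eval, Trm.subst, ih]
    refine Quotient.sound (s := h.setoid Δ) (h.cut_all ?_ (h.2.2.2.2.1 f _ _))
    rw [Finset.forall_mem_image]
    intro i _
    exact Quotient.mk_out (s := h.setoid Δ) _

theorem quotientAlg_eval_eq_iff (h : MHyperclosed M S) (Δ : Finset (Eqn I ar))
    (δ : ℕ → Trm I ar) (t s : Trm I ar) :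
    (h.quotientAlg Δ).eval (fun n => Quotient.mk (h.setoid Δ) (δ n)) t =
        (h.quotientAlg Δ).eval (fun n => Quotient.mk (h.setoid Δ) (δ n)) s ↔
      (Δ, (t.subst δ, s.subst δ)) ∈ S := by
  rw [quotientAlg_eval, quotientAlg_eval]
  exact Quotient.eq (r := h.setoid Δ)

theorem quotientAlg_sat (h : MHyperclosed M S) (Δ : Finset (Eqn I ar)) {q : Quasi I ar}
    (hq : q ∈ S) : (h.quotientAlg Δ).Sat q := by
  intro v hv
  obtain ⟨δ, rfl⟩ : ∃ δ : ℕ → Trm I ar, v = fun n => Quotient.mk (h.setoid Δ) (δ n) :=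
    ⟨fun n => Quotient.out (v n), funext fun n => (Quotient.out_eq (v n)).symm⟩
  simp only [quotientAlg_eval_eq_iff] at hv ⊢
  refine h.cut_all ?_ (h.2.2.2.2.2.1 q hq δ)
  rw [Finset.forall_mem_image]
  exact hv

theorem mem_of_quotientAlg_sat (h : MHyperclosed M S) {q : Quasi I ar}
    (hq : (h.quotientAlg q.1).Sat q) : q ∈ S := by
  have := hq fun n => Quotient.mk (h.setoid q.1) (.var n)
  simp only [quotientAlg_eval_eq_iff, Trm.subst_var] at this
  exact this fun p hp => h.mem_of_mem hp

end MHyperclosed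

/-- Let `M` be a submonoid of `H(τ)`.  A set `Σ` of quasi-identities of type `τ`
is the set of all quasi-identities `M`-hypersatisfied in some class `K` of
algebras of type `τ` if and only if `Σ` is `M`-hyperclosed. -/
theorem M_hypersatisfied_iff_M_hyperclosed (M : Set (Hyp I ar))
    (hM : ∀ σ ∈ M, IsHyp σ) (hid : Hyp.id I ar ∈ M)
    (hcomp : ∀ σ₁ ∈ M, ∀ σ₂ ∈ M, Hyp.comp σ₁ σ₂ ∈ M)
    (S : Set (Quasi I ar)) :
    (∃ K : Set (Alg I ar), S = {q : Quasi I ar | ∀ A ∈ K, A.HypSatM M q}) ↔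
      MHyperclosed M S := by
  constructor
  · rintro ⟨K, rfl⟩
    exact mHyperclosed_hypSatM hM hcomp K
  · intro h
    refine ⟨{A | ∀ q ∈ S, A.HypSatM M q}, Set.Subset.antisymm (fun q hq A hA => hA q hq) ?_⟩
    intro q hq
    have hmem : ∀ p ∈ S, (h.quotientAlg q.1).HypSatM M p := fun p hp σ hσ =>
      h.quotientAlg_sat q.1 (h.2.2.2.2.2.2.1 p hp σ hσ)
    have hsat := hq _ hmem _ hid
    simp only [Alg.sat_mapQ, Hyp.apply_id] at hsat
    exact h.mem_of_quotientAlg_sat hsat
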